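/- Let E be a small category, let C = Fun(E, Set), and let κ be a regular cardinal such that E has fewer than κ morphisms. Then there exists a regular cardinal π ≥ κ such that for every regular cardinal μ ≥ π there exists a regular cardinal γ ≥ μ with the following property: every morphism f : A → B in C with A γ-presentable admits a factorization f = f' ∘ g with g : A → A' and f' : A' → B, where A' is γ-presentable and f' is μ-pure. -/

import Mathlib

/-!
STATEMENT 4: Let E be a small category with fewer than κ morphisms (κ regular) and
C = Fun(E, Set). Then there is a regular π ≥ κ such that for every regular μ ≥ π there
is a regular γ ≥ μ such that every morphism f : A → B with A γ-presentable factors as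
f = f' ∘ g with g : A → A', f' : A' → B, A' γ-presentable and f' μ-pure.
-/

universe v

open CategoryTheory CategoryTheory.Limits Opposite

namespace Reflection

def IsCardinalFiltered (J : Type u₂) [Category.{v₂} J] (κ : Cardinal.{v}) : Prop :=
  ∀ (A : Type v) [SmallCategory A],
    Cardinal.mk (Σ (a : A) (b : A), a ⟶ b) < κ →
      ∀ F : A ⥤ J, Nonempty (Cocone F)

variable {C : Type u} [Category.{v} C]

def IsPresentableObj (κ : Cardinal.{v}) (X : C) : Prop :=
  ∀ (J : Type v) [SmallCategory J], IsCardinalFiltered J κ →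
    ∀ (F : J ⥤ C) (c : Cocone F), IsColimit c →
      Nonempty (IsColimit ((coyoneda.obj (op X)).mapCocone c))

def IsPure (μ : Cardinal.{v}) {A B : C} (f : A ⟶ B) : Prop :=
  ∀ ⦃A' B' : C⦄ (f' : A' ⟶ B') (u : A' ⟶ A) (v : B' ⟶ B),
    IsPresentableObj μ A' → IsPresentableObj μ B' →
      u ≫ f = f' ≫ v → ∃ ub : B' ⟶ A, f' ≫ ub = u

lemma isCardinalFiltered_iff_isCardinalFiltered {J : Type v} [SmallCategory J] {γ : Cardinal.{v}}
    [Fact γ.IsRegular] :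
    IsCardinalFiltered J γ ↔ CategoryTheory.IsCardinalFiltered J γ := by
  have key (A : Type v) [SmallCategory A] :
      Cardinal.mk (Σ (a : A) (b : A), a ⟶ b) = Cardinal.mk (Arrow A) :=
    Cardinal.mk_congr
      { toFun x := Arrow.mk x.2.2
        invFun f := ⟨f.left, f.right, f.hom⟩
        left_inv _ := rfl
        right_inv _ := rfl }
  constructor
  · intro h
    exact ⟨fun {A} _ F hA ↦ h A (by rwa [key, ← hasCardinalLT_iff_cardinal_mk_lt]) F⟩
  · intro h A _ hA F
    exact h.nonempty_cocone F (by rwa [hasCardinalLT_iff_cardinal_mk_lt, ← key])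

lemma isPresentableObj_iff {C : Type u} [Category.{v} C] {γ : Cardinal.{v}} [Fact γ.IsRegular]
    (X : C) : IsPresentableObj γ X ↔ IsCardinalPresentable X γ := by
  constructor
  · intro h
    exact ⟨fun J _ hJ ↦ ⟨fun {F} ↦ ⟨fun {c} hc ↦
      h J (isCardinalFiltered_iff_isCardinalFiltered.2 hJ) F c hc⟩⟩⟩
  · intro h J _ hJ F c hc
    have := isCardinalFiltered_iff_isCardinalFiltered.1 hJ
    have := preservesColimitsOfShape_of_isCardinalPresentable X γ J
    exact ⟨isColimitOfPreserves (coyoneda.obj (op X)) hc⟩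

section Presentable

variable {E : Type v} [SmallCategory E] {γ : Cardinal.{v}}

lemma hasCardinalLT_sigma_hom (hE : Cardinal.mk (Σ (a : E) (b : E), a ⟶ b) < γ) (e : E) :
    HasCardinalLT (Σ b : E, e ⟶ b) γ :=
  ((hasCardinalLT_iff_cardinal_mk_lt _ _).2 hE).of_injective
    (fun p ↦ (⟨e, p⟩ : Σ (a : E) (b : E), a ⟶ b)) fun _ _ h ↦ eq_of_heq (Sigma.mk.inj h).2

/-- The subfunctor generated by an element. -/
def generatedSubfunctor (A : E ⥤ Type v) {e : E} (a : A.obj e) : Subfunctor A :=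
  Subfunctor.range (coyonedaEquiv.symm a)

lemma hasCardinalLT_generatedSubfunctor (hE : Cardinal.mk (Σ (a : E) (b : E), a ⟶ b) < γ)
    (A : E ⥤ Type v) {e : E} (a : A.obj e) :
    HasCardinalLT (Σ e', (generatedSubfunctor A a).obj e') γ := by
  refine (hasCardinalLT_sigma_hom hE e).of_surjective
    (fun p ↦ ⟨p.1, (coyonedaEquiv.symm a).app p.1 p.2, p.2, rfl⟩) ?_
  rintro ⟨e', _, g, rfl⟩
  exact ⟨⟨e', g⟩, rfl⟩

variable [Fact γ.IsRegular]

instance isCardinalPresentable_coyoneda (e : Eᵒᵖ) :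
    IsCardinalPresentable (coyoneda.obj e) γ where
  preservesColimitOfShape J _ _ :=
    preservesColimitsOfShape_of_natIso
      (NatIso.ofComponents (fun P ↦ (coyonedaEquiv (F := P)).symm.toIso) (by
        intro P Q f
        ext x
        apply coyonedaEquiv.injective
        simp [coyonedaEquiv]) :
        (evaluation E (Type v)).obj e.unop ≅ coyoneda.obj (op (coyoneda.obj e)))

/-- The cocone exhibiting a functor to types as a colimit of corepresentable functors. -/
def elementsCocone (A : E ⥤ Type v) : Cocone ((CategoryOfElements.π A).op ⋙ coyoneda) where
  pt := A
  ι :=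
    { app x := coyonedaEquiv.symm x.unop.2
      naturality x y f := by
        ext e g
        exact (ConcreteCategory.congr_hom (A.map_comp f.unop.1 g) y.unop.2).trans
          (congr_arg (A.map g) f.unop.2) }

lemma cocone_app_eq_app_map_id {A : E ⥤ Type v}
    (s : Cocone ((CategoryOfElements.π A).op ⋙ coyoneda)) {e e' : E} (a : A.obj e) (g : e ⟶ e') :
    (s.ι.app (op ⟨e, a⟩)).app e' g = (s.ι.app (op ⟨e', A.map g a⟩)).app e' (𝟙 e') := by
  let h : A.elementsMk e a ⟶ A.elementsMk e' (A.map g a) := ⟨g, rfl⟩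
  have h₁ := ConcreteCategory.congr_hom (congr_app (s.w h.op) e') (𝟙 e')
  refine Eq.trans ?_ h₁
  exact congr_arg ((s.ι.app (op ⟨e, a⟩)).app e') (Category.comp_id g).symm

/-- Every functor to types is a colimit of corepresentable functors. -/
def isColimitElementsCocone (A : E ⥤ Type v) : IsColimit (elementsCocone A) where
  desc s :=
    { app e := ↾fun a ↦ (s.ι.app (op ⟨e, a⟩)).app e (𝟙 e)
      naturality e e' φ := by
        ext a
        refine (cocone_app_eq_app_map_id s a φ).symm.trans ?_
        have := NatTrans.naturality_apply (s.ι.app (op (A.elementsMk e a))) φ (𝟙 e)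
        refine Eq.trans ?_ this
        exact congr_arg ((s.ι.app (op ⟨e, a⟩)).app e') (Category.id_comp φ).symm }
  fac s x := by
    ext e g
    exact (cocone_app_eq_app_map_id s x.unop.2 g).symm
  uniq s m hm := by
    ext e a
    have h : A.map (𝟙 e) a = a := ConcreteCategory.congr_hom (A.map_id e) a
    exact (congr_arg (m.app e) h.symm).trans
      (ConcreteCategory.congr_hom (congr_app (hm (op ⟨e, a⟩)) e) (𝟙 e))

lemma isCardinalPresentable_of_mk_lt (hE : Cardinal.mk (Σ (a : E) (b : E), a ⟶ b) < γ)
    (A : E ⥤ Type v) (hA : Cardinal.mk (Σ e, A.obj e) < γ) : IsCardinalPresentable A γ := by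
  have hK : HasCardinalLT (Arrow A.Elementsᵒᵖ) γ := by
    have h : HasCardinalLT (Σ x : A.Elements, Σ e', x.1 ⟶ e') γ :=
      hasCardinalLT_sigma _ _ ((hasCardinalLT_iff_cardinal_mk_lt _ _).2 hA)
        fun x ↦ hasCardinalLT_sigma_hom hE x.1
    refine h.of_surjective
      (fun p ↦ Arrow.mk (Quiver.Hom.op
        (⟨p.2.2, rfl⟩ : p.1 ⟶ A.elementsMk p.2.1 (A.map p.2.2 p.1.2)))) ?_
    rintro ⟨⟨⟨e', b⟩⟩, ⟨⟨e, a⟩⟩, ⟨(φ : e ⟶ e'), (hφ : A.map φ a = b)⟩⟩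
    subst hφ
    exact ⟨⟨⟨e, a⟩, e', φ⟩, rfl⟩
  have (k : _) : IsCardinalPresentable (((CategoryOfElements.π A).op ⋙ coyoneda).obj k) γ := by
    dsimp
    infer_instance
  exact isCardinalPresentable_of_isColimit _ (isColimitElementsCocone A) γ hK

/-- The subfunctors of `A` with fewer than `γ` elements. -/
abbrev SmallSubfunctor (A : E ⥤ Type v) (γ : Cardinal.{v}) : Type v :=
  { S : Subfunctor A // HasCardinalLT (Σ e, S.obj e) γ }

lemma isCardinalFiltered_smallSubfunctor (A : E ⥤ Type v) :
    CategoryTheory.IsCardinalFiltered (SmallSubfunctor A γ) γ := by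
  refine isCardinalFiltered_preorder _ _ fun K s hK ↦ ⟨⟨⨆ k, (s k).1, ?_⟩, fun k ↦
    le_iSup (fun k ↦ (s k).1) k⟩
  have : HasCardinalLT (Σ k, Σ e, (s k).1.obj e) γ :=
    hasCardinalLT_sigma _ _ ((hasCardinalLT_iff_cardinal_mk_lt _ _).2 hK) fun k ↦ (s k).2
  refine this.of_surjective (fun p ↦ ⟨p.2.1, p.2.2.1, ?_⟩) ?_
  · rw [Subfunctor.iSup_obj]
    exact Set.mem_iUnion_of_mem p.1 p.2.2.2
  · rintro ⟨e, x, hx⟩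
    rw [Subfunctor.iSup_obj] at hx
    obtain ⟨k, hk⟩ := Set.mem_iUnion.1 hx
    exact ⟨⟨k, e, x, hk⟩, rfl⟩

/-- The cocone exhibiting `A` as the union of its subfunctors with fewer than `γ` elements. -/
def smallSubfunctorCocone (A : E ⥤ Type v) (γ : Cardinal.{v}) :
    Cocone (J := SmallSubfunctor A γ) (C := E ⥤ Type v)
      { obj S := S.1.toFunctor
        map f := Subfunctor.homOfLe (leOfHom f) } where
  pt := A
  ι := { app S := S.1.ι }

/-- Every functor to types is the union of its subfunctors with fewer than `γ` elements. -/
noncomputable def isColimitSmallSubfunctorCocone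
    (hE : Cardinal.mk (Σ (a : E) (b : E), a ⟶ b) < γ) (A : E ⥤ Type v) :
    IsColimit (smallSubfunctorCocone A γ) :=
  evaluationJointlyReflectsColimits _ fun e ↦ by
    have := isCardinalFiltered_smallSubfunctor (γ := γ) A
    have := isFiltered_of_isCardinalFiltered (SmallSubfunctor A γ) γ
    refine Types.FilteredColimit.isColimitOf' _ _ (fun a ↦ ?_) fun S x y h ↦ ?_
    · exact ⟨⟨_, hasCardinalLT_generatedSubfunctor hE A a⟩,
        ⟨a, 𝟙 e, ConcreteCategory.congr_hom (A.map_id e) a⟩, rfl⟩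
    · exact ⟨S, 𝟙 S, congr_arg _ (Subtype.ext h)⟩

lemma mk_lt_of_isCardinalPresentable (hE : Cardinal.mk (Σ (a : E) (b : E), a ⟶ b) < γ)
    (A : E ⥤ Type v) [IsCardinalPresentable A γ] : Cardinal.mk (Σ e, A.obj e) < γ := by
  have := isCardinalFiltered_smallSubfunctor (γ := γ) A
  obtain ⟨S, f, hf⟩ := IsCardinalPresentable.exists_hom_of_isColimit γ
    (isColimitSmallSubfunctorCocone hE A) (𝟙 A)
  rw [← hasCardinalLT_iff_cardinal_mk_lt]
  refine S.2.of_injective (fun p ↦ ⟨p.1, f.app p.1 p.2⟩) ?_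
  refine Function.LeftInverse.injective (g := fun p ↦ ⟨p.1, p.2.1⟩) ?_
  rintro ⟨e, a⟩
  have h := ConcreteCategory.congr_hom (congr_app hf e) a
  exact Sigma.ext rfl (heq_of_eq h)

end Presentable

section SmallModel

variable (E : Type v) [SmallCategory E] (W : Type v)

/-- A small category of types, consisting of the subsets of `W`. -/
abbrev SubsetCat : Type v := InducedCategory (Type v) (fun s : Set W ↦ (s : Type v))

/-- The underlying type of an object of `SubsetCat W`. -/
abbrev SubsetCat.forget : SubsetCat W ⥤ Type v := inducedFunctor _

variable {E W}

lemma exists_subsetCat_iso (P : E ⥤ Type v) (hP : Cardinal.mk (Σ e, P.obj e) ≤ Cardinal.mk W) :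
    ∃ P' : E ⥤ SubsetCat W, Nonempty (P' ⋙ SubsetCat.forget W ≅ P) := by
  obtain ⟨i⟩ := hP
  have hP (e : E) : (SubsetCat.forget W).essImage (P.obj e) := by
    refine ⟨(Set.range fun x : P.obj e ↦ i ⟨e, x⟩ : Set W), ⟨Equiv.toIso ?_⟩⟩
    exact (Equiv.ofInjective (fun x : P.obj e ↦ i ⟨e, x⟩)
      (i.injective.comp sigma_mk_injective)).symm
  exact ⟨_, ⟨Functor.essImage.liftFunctorCompIso P _ hP⟩⟩

/-- A natural transformation between two functors valued in subsets of `W`. -/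
abbrev SubsetMap (E W : Type v) [SmallCategory E] : Type v :=
  Σ P Q : E ⥤ SubsetCat W, P ⋙ SubsetCat.forget W ⟶ Q ⋙ SubsetCat.forget W

/-- A subfunctor `S` of `B` such that any natural transformation `h` between functors valued in
subsets of `W` has the extension property with respect to the inclusion of `S` as soon as
it has it in `B`. -/
def IsPureSubfunctor (W : Type v) {B : E ⥤ Type v} (S : Subfunctor B) : Prop :=
  ∀ (h : SubsetMap E W) (u : h.1 ⋙ SubsetCat.forget W ⟶ S.toFunctor)
    (v : h.2.1 ⋙ SubsetCat.forget W ⟶ B), u ≫ S.ι = h.2.2 ≫ v →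
      ∃ w : h.2.1 ⋙ SubsetCat.forget W ⟶ S.toFunctor, h.2.2 ≫ w = u

lemma IsPureSubfunctor.isPure {μ : Cardinal.{v}} (hμ : μ.IsRegular) (hW : Cardinal.mk W = μ)
    (hE : Cardinal.mk (Σ (a : E) (b : E), a ⟶ b) < μ)
    {B : E ⥤ Type v} {S : Subfunctor B} (hS : IsPureSubfunctor W S) : IsPure μ S.ι := by
  intro P Q h u v hP hQ sq
  have : Fact μ.IsRegular := ⟨hμ⟩
  rw [isPresentableObj_iff] at hP hQ
  obtain ⟨P', ⟨eP⟩⟩ := exists_subsetCat_iso (W := W) P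
    ((mk_lt_of_isCardinalPresentable hE P).le.trans_eq hW.symm)
  obtain ⟨Q', ⟨eQ⟩⟩ := exists_subsetCat_iso (W := W) Q
    ((mk_lt_of_isCardinalPresentable hE Q).le.trans_eq hW.symm)
  obtain ⟨w, hw⟩ := hS ⟨P', Q', eP.hom ≫ h ≫ eQ.inv⟩ (eP.hom ≫ u) (eQ.hom ≫ v) (by simp [sq])
  refine ⟨eQ.inv ≫ w, ?_⟩
  rw [← cancel_epi eP.hom]
  simpa using hw

end SmallModel

/-- A set closed under a family of nondeterministic operations. -/
lemma exists_closed_set {X I : Type v} (β δ : I → Type v)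
    (R : ∀ i, (β i → X) → (δ i → X) → Prop) {ν : Cardinal.{v}} (hν : Cardinal.aleph0 ≤ ν)
    (hI : Cardinal.mk I ≤ ν) (hβ : ∀ i, Cardinal.mk (β i) ≤ ν) (hδ : ∀ i, Cardinal.mk (δ i) ≤ ν)
    (S₀ : Set X) (hS₀ : Cardinal.mk S₀ ≤ 2 ^ ν) :
    ∃ S : Set X, S₀ ⊆ S ∧ Cardinal.mk S ≤ 2 ^ ν ∧ ∀ i a, (∀ b, a b ∈ S) → (∃ y, R i a y) →
      ∃ y, R i a y ∧ ∀ d, y d ∈ S := by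
  classical
  rcases isEmpty_or_nonempty X with hX | ⟨⟨x₀⟩⟩
  · exact ⟨∅, fun x ↦ isEmptyElim x, by simp, fun i a _ ⟨y, hy⟩ ↦
      ⟨y, hy, fun d ↦ isEmptyElim (y d)⟩⟩
  let α := S₀ ⊕ Σ i, δ i
  let ar : α → Type v := Sum.elim (fun _ ↦ PEmpty) (fun p ↦ β p.1)
  let step : (Σ a : α, ar a → X) → X := fun
    | ⟨.inl s, _⟩ => s
    | ⟨.inr p, f⟩ => if h : ∃ y, R p.1 f y then h.choose p.2 else x₀
  let ev : WType ar → X := WType.elim X step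
  have two_pow_pow : (2 ^ ν : Cardinal.{v}) ^ ν = 2 ^ ν := by
    rw [← Cardinal.power_mul, Cardinal.mul_eq_self hν]
  have hν' : ν ≤ 2 ^ ν := (Cardinal.cantor ν).le
  have hW : Cardinal.mk (WType ar) ≤ 2 ^ ν := by
    refine WType.cardinalMk_le_of_le ?_
    calc Cardinal.sum (fun a ↦ (2 ^ ν) ^ Cardinal.mk (ar a))
      _ ≤ Cardinal.sum (fun _ : α ↦ (2 ^ ν : Cardinal.{v})) := by
        refine Cardinal.sum_le_sum _ _ fun a ↦ ?_
        conv_rhs => rw [← two_pow_pow]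
        refine Cardinal.power_le_power_left (Cardinal.power_ne_zero _ two_ne_zero) ?_
        rcases a with s | p
        · simp [ar]
        · exact hβ p.1
      _ = Cardinal.mk α * 2 ^ ν := by simp
      _ ≤ 2 ^ ν * 2 ^ ν := by
        gcongr
        rw [Cardinal.mk_sum, Cardinal.lift_id, Cardinal.lift_id]
        refine Cardinal.add_le_of_le (hν.trans hν') hS₀ ?_
        rw [Cardinal.mk_sigma]
        refine (Cardinal.sum_le_sum _ (fun _ ↦ ν) hδ).trans ?_
        simp only [Cardinal.sum_const, Cardinal.lift_id]
        exact (mul_le_mul' hI le_rfl).trans ((Cardinal.mul_eq_self hν).le.trans hν')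
      _ = 2 ^ ν := Cardinal.mul_eq_self (hν.trans hν')
  refine ⟨Set.range ev, fun x hx ↦ ⟨.mk (.inl ⟨x, hx⟩) PEmpty.elim, rfl⟩,
    Cardinal.mk_range_le.trans hW, fun i a ha h ↦ ?_⟩
  choose t ht using ha
  obtain rfl : (fun b ↦ ev (t b)) = a := funext ht
  refine ⟨h.choose, h.choose_spec, fun d ↦ ⟨.mk (.inr ⟨i, d⟩) t, ?_⟩⟩
  exact dif_pos h

lemma exists_isPureSubfunctor {E : Type v} [SmallCategory E] (W : Type v) {ν : Cardinal.{v}}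
    (hν : Cardinal.aleph0 ≤ ν)
    (hE : Cardinal.mk (Σ (a : E) (b : E), a ⟶ b) ≤ ν) (hI : Cardinal.mk (SubsetMap E W) ≤ ν)
    (hEW : Cardinal.mk (E × W) ≤ ν) (B : E ⥤ Type v) (T : Set (Σ e, B.obj e))
    (hT : Cardinal.mk T ≤ 2 ^ ν) :
    ∃ S : Subfunctor B, IsPureSubfunctor W S ∧ (∀ e b, ⟨e, b⟩ ∈ T → b ∈ S.obj e) ∧
      Cardinal.mk (Σ e, S.obj e) ≤ 2 ^ ν := by
  have hsub (P : E ⥤ SubsetCat W) :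
      Cardinal.mk (Σ e, (P ⋙ SubsetCat.forget W).obj e) ≤ ν := by
    refine (Cardinal.mk_le_of_injective (f := fun p ↦ (p.1, p.2.1)) ?_).trans hEW
    rintro ⟨e, x⟩ ⟨e', x'⟩ h
    obtain ⟨rfl, h⟩ := Prod.mk.inj h
    exact Sigma.ext rfl (heq_of_eq (Subtype.ext h))
  let β : (Σ (a : E) (b : E), a ⟶ b) ⊕ SubsetMap E W → Type v := Sum.elim (fun _ ↦ PUnit)
    fun h ↦ Σ e, (h.1 ⋙ SubsetCat.forget W).obj e
  let δ : (Σ (a : E) (b : E), a ⟶ b) ⊕ SubsetMap E W → Type v := Sum.elim (fun _ ↦ PUnit)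
    fun h ↦ Σ e, (h.2.1 ⋙ SubsetCat.forget W).obj e
  let R : ∀ i, (β i → Σ e, B.obj e) → (δ i → Σ e, B.obj e) → Prop := fun
    | .inl φ => fun a y ↦ ∃ b, a ⟨⟩ = ⟨φ.1, b⟩ ∧ y ⟨⟩ = ⟨φ.2.1, B.map φ.2.2 b⟩
    | .inr h => fun a y ↦ ∃ v : h.2.1 ⋙ SubsetCat.forget W ⟶ B,
        (∀ p, a p = ⟨p.1, (h.2.2 ≫ v).app p.1 p.2⟩) ∧ ∀ q, y q = ⟨q.1, v.app q.1 q.2⟩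
  obtain ⟨S, hTS, hS, hR⟩ := exists_closed_set β δ R hν
    (by
      rw [Cardinal.mk_sum, Cardinal.lift_id, Cardinal.lift_id]
      exact Cardinal.add_le_of_le hν hE hI)
    (by
      rintro (φ | h)
      · exact Cardinal.mk_punit.trans_le (Cardinal.one_le_aleph0.trans hν)
      · exact hsub h.1)
    (by
      rintro (φ | h)
      · exact Cardinal.mk_punit.trans_le (Cardinal.one_le_aleph0.trans hν)
      · exact hsub h.2.1) T hT
  let S' : Subfunctor B :=
    { obj e := { b | ⟨e, b⟩ ∈ S }
      map {e e'} φ b hb := by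
        obtain ⟨y, ⟨b', hb', hy'⟩, hy⟩ :=
          hR (.inl ⟨e, e', φ⟩) (fun _ ↦ ⟨e, b⟩) (fun _ ↦ hb) ⟨fun _ ↦ ⟨e', B.map φ b⟩, b, rfl, rfl⟩
        obtain rfl : b = b' := eq_of_heq (Sigma.mk.inj hb').2
        have := hy ⟨⟩
        rwa [hy'] at this }
  refine ⟨S', ?_, fun e b h ↦ hTS h, ?_⟩
  · intro h u v sq
    have sq' (e : E) (x : (h.1 ⋙ SubsetCat.forget W).obj e) :
        (u.app e x).1 = v.app e (h.2.2.app e x) := by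
      have h := ConcreteCategory.congr_hom (congr_app sq e) x
      exact h
    obtain ⟨y, ⟨v', hv', hy'⟩, hy⟩ := hR (.inr h) (fun p ↦ ⟨p.1, (u.app p.1 p.2).1⟩)
      (fun p ↦ (u.app p.1 p.2).2)
      ⟨fun q ↦ ⟨q.1, v.app q.1 q.2⟩, v, fun p ↦ Sigma.ext rfl (heq_of_eq (sq' p.1 p.2)),
        fun _ ↦ rfl⟩
    refine ⟨Subfunctor.lift v' ?_, ?_⟩
    · rintro e _ ⟨x, rfl⟩
      change (⟨e, v'.app e x⟩ : Σ e, B.obj e) ∈ S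
      exact Set.mem_of_eq_of_mem (hy' ⟨e, x⟩).symm (hy ⟨e, x⟩)
    · ext e x
      exact Subtype.ext (eq_of_heq (Sigma.mk.inj (hv' ⟨e, x⟩)).2).symm
  · refine (Cardinal.mk_le_of_injective (β := S) (f := fun p ↦ ⟨⟨p.1, p.2.1⟩, p.2.2⟩) ?_).trans hS
    rintro ⟨e, x⟩ ⟨e', x'⟩ h
    obtain ⟨rfl, h⟩ := Sigma.mk.inj (congr_arg Subtype.val h)
    exact Sigma.ext rfl (heq_of_eq (Subtype.ext (eq_of_heq h)))

theorem factorization_through_pure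
    (E : Type v) [SmallCategory E] (κ : Cardinal.{v}) (hκ : κ.IsRegular)
    (hE : Cardinal.mk (Σ (a : E) (b : E), a ⟶ b) < κ) :
    ∃ π : Cardinal.{v}, π.IsRegular ∧ κ ≤ π ∧
      ∀ μ : Cardinal.{v}, μ.IsRegular → π ≤ μ →
        ∃ γ : Cardinal.{v}, γ.IsRegular ∧ μ ≤ γ ∧
          ∀ ⦃A B : E ⥤ Type v⦄ (f : A ⟶ B), IsPresentableObj γ A →
            ∃ (A' : E ⥤ Type v) (g : A ⟶ A') (f' : A' ⟶ B),
              IsPresentableObj γ A' ∧ IsPure μ f' ∧ g ≫ f' = f := by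
  refine ⟨κ, hκ, le_rfl, fun μ hμ hκμ ↦ ?_⟩
  let W := μ.out
  let ν := max (max μ (Cardinal.mk (SubsetMap E W))) (Cardinal.mk (E × W))
  have hμν : μ ≤ ν := (le_max_left _ _).trans (le_max_left _ _)
  have hν : Cardinal.aleph0 ≤ ν := hμ.aleph0_le.trans hμν
  have hν' : ν ≤ 2 ^ ν := (Cardinal.cantor ν).le
  have hγ : (Order.succ (2 ^ ν : Cardinal.{v})).IsRegular := Cardinal.isRegular_succ (hν.trans hν')
  have : Fact (Order.succ (2 ^ ν : Cardinal.{v})).IsRegular := ⟨hγ⟩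
  have hEμ := hE.trans_le hκμ
  have hEν := hEμ.le.trans hμν
  have hEγ := Order.lt_succ_of_le (hEν.trans hν')
  refine ⟨Order.succ (2 ^ ν : Cardinal.{v}), hγ, (hμν.trans hν').trans (Order.le_succ _),
    fun A B f hA ↦ ?_⟩
  rw [isPresentableObj_iff] at hA
  have hA' := Order.le_of_lt_succ (mk_lt_of_isCardinalPresentable hEγ A)
  obtain ⟨S, hpure, hS, hcard⟩ := exists_isPureSubfunctor W hν hEν
    ((le_max_right _ _).trans (le_max_left _ _)) (le_max_right _ _) B
    (Set.range fun p : Σ e, A.obj e ↦ ⟨p.1, f.app p.1 p.2⟩) (Cardinal.mk_range_le.trans hA')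
  refine ⟨S.toFunctor, Subfunctor.lift f ?_, S.ι, ?_,
    hpure.isPure hμ μ.mk_out hEμ, Subfunctor.lift_ι _ _⟩
  · rintro e _ ⟨x, rfl⟩
    exact hS _ _ ⟨⟨e, x⟩, rfl⟩
  · rw [isPresentableObj_iff]
    exact isCardinalPresentable_of_mk_lt hEγ _ (Order.lt_succ_of_le hcard)

end Reflection
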